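/- arXiv:math/0702027 — 2 statements merged into one kernel-verified Lean document; each statement's English description precedes it below -/
import Mathlib

section
/- For any positive integer t, every coefficient of the formal power series E(q^t)^t / E(q), where E(q) = ∏_{n≥1}(1-q^n), is nonnegative. In fact, the coefficient of q^n counts the number of partitions of n that are t-cores. -/
/-- `E(q) = ∏_{n ≥ 1} (1 - qⁿ)`. -/
noncomputable def Eprod (q : ℂ) : ℂ := ∏' n : ℕ, (1 - q ^ (n + 1))

/-- The parts of a partition, sorted in weakly decreasing order. -/
def sortedParts {n : ℕ} (p : n.Partition) : List ℕ := p.parts.sort (· ≥ ·)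

/-- The hook length of the cell `(i,j)` (0-indexed) of a partition:
`λᵢ + λ'ⱼ - i - j - 1`, where `λ'ⱼ` is the number of parts exceeding `j`. -/
def hookLen {n : ℕ} (p : n.Partition) (i j : ℕ) : ℤ :=
  ((sortedParts p).getD i 0 : ℤ) +
    ((p.parts.filter (fun x => j < x)).card : ℤ) - i - j - 1

/-- A partition is a `t`-core if no hook length equals `t`. -/
def IsTCore (t : ℕ) {n : ℕ} (p : n.Partition) : Prop :=
  ∀ i j : ℕ, j < (sortedParts p).getD i 0 → hookLen p i j ≠ (t : ℤ)

section QBinomial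

variable {K : Type*} [Field K]

/-- The finite product `(1 - q)(1 - q²)⋯(1 - q^N)`. -/
def qPoch (q : K) (N : ℕ) : K := ∏ n ∈ Finset.range N, (1 - q ^ (n + 1))

/-- Euler's series `∑ q^(N choose 2) z^N / ((1 - q)⋯(1 - q^N))`. -/
noncomputable def eulerSeries (q : K) : PowerSeries K :=
  PowerSeries.mk fun N => q ^ N.choose 2 * (qPoch q N)⁻¹

lemma eulerSeries_eq_mul_rescale {q : K} (hq : ∀ n : ℕ, q ^ (n + 1) ≠ 1) :
    eulerSeries q = (1 + PowerSeries.X) * PowerSeries.rescale q (eulerSeries q) := by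
  ext N
  rw [add_mul, one_mul, map_add]
  cases N with
  | zero => simp [eulerSeries, qPoch]
  | succ N =>
    have h : (1 : K) - q ^ (N + 1) ≠ 0 := sub_ne_zero.2 (hq N).symm
    simp only [PowerSeries.coeff_succ_X_mul, PowerSeries.coeff_rescale, eulerSeries,
      PowerSeries.coeff_mk, qPoch, Finset.prod_range_succ, mul_inv]
    have hc : (N + 1).choose 2 = N + N.choose 2 := by
      rw [Nat.choose_succ_succ' N 1, Nat.choose_one_right]
    rw [hc, pow_add]
    field_simp
    ring

lemma eq_of_eq_mul_rescale {q : K} (hq : ∀ n : ℕ, q ^ (n + 1) ≠ 1) {f g : PowerSeries K}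
    (hf : f = (1 + PowerSeries.X) * PowerSeries.rescale q f)
    (hg : g = (1 + PowerSeries.X) * PowerSeries.rescale q g)
    (h0 : PowerSeries.coeff 0 f = PowerSeries.coeff 0 g) : f = g := by
  have key : ∀ {f : PowerSeries K}, f = (1 + PowerSeries.X) * PowerSeries.rescale q f →
      ∀ N, (1 - q ^ (N + 1)) * PowerSeries.coeff (N + 1) f = q ^ N * PowerSeries.coeff N f := by
    intro f hf N
    have h := congrArg (PowerSeries.coeff (N + 1)) hf
    rw [add_mul, one_mul, map_add, PowerSeries.coeff_succ_X_mul, PowerSeries.coeff_rescale,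
      PowerSeries.coeff_rescale] at h
    linear_combination h
  ext N
  induction N with
  | zero => exact h0
  | succ N ih =>
    refine mul_left_cancel₀ (sub_ne_zero.2 (hq N).symm) ?_
    rw [key hf, key hg, ih]

lemma prod_rescale_eulerSeries {q : K} (hq : ∀ n : ℕ, q ^ (n + 1) ≠ 1) {t : ℕ} (ht : 0 < t) :
    ∏ r : Fin t, PowerSeries.rescale (q ^ (r : ℕ)) (eulerSeries (q ^ t)) = eulerSeries q := by
  have hqt : ∀ n : ℕ, (q ^ t) ^ (n + 1) ≠ 1 := fun n => by
    obtain ⟨m, hm⟩ : ∃ m, t * (n + 1) = m + 1 :=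
      Nat.exists_eq_succ_of_ne_zero (Nat.mul_pos ht n.succ_pos).ne'
    rw [← pow_mul, hm]
    exact hq m
  rw [Fin.prod_univ_eq_prod_range
    (fun r => PowerSeries.rescale (q ^ r) (eulerSeries (q ^ t))) t]
  refine eq_of_eq_mul_rescale hq ?_ (eulerSeries_eq_mul_rescale hq) ?_
  · set R := PowerSeries.rescale (q ^ t) (eulerSeries (q ^ t)) with hR
    have hR0 : R ≠ 0 := fun h => by
      have := congrArg (PowerSeries.coeff 0) h
      simp [hR, eulerSeries, qPoch] at this
    have hG : eulerSeries (q ^ t) = (1 + PowerSeries.X) * R := eulerSeries_eq_mul_rescale hqt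
    have hshift : PowerSeries.rescale q
        (∏ r ∈ Finset.range t, PowerSeries.rescale (q ^ r) (eulerSeries (q ^ t))) =
        ∏ r ∈ Finset.range t, PowerSeries.rescale (q ^ (r + 1)) (eulerSeries (q ^ t)) := by
      rw [map_prod]
      refine Finset.prod_congr rfl fun r _ => ?_
      rw [PowerSeries.rescale_rescale, pow_succ]
    have htel := (Finset.prod_range_succ
      (fun r => PowerSeries.rescale (q ^ r) (eulerSeries (q ^ t))) t).symm.trans
      (Finset.prod_range_succ' _ t)
    rw [pow_zero, PowerSeries.rescale_one, RingHom.id_apply, ← hshift, hG, ← hG, ← hR] at htel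
    refine mul_right_cancel₀ hR0 ?_
    rw [htel]
    nth_rw 2 [hG]
    ring
  · simp [eulerSeries, qPoch, PowerSeries.coeff_prod]

lemma sum_prod_inv_qPoch {q : K} (hq : ∀ n : ℕ, q ^ (n + 1) ≠ 1) {t : ℕ} (ht : 0 < t) (N : ℕ) :
    ∑ ν ∈ (Finset.univ : Finset (Fin t)).finsuppAntidiag N,
      q ^ (∑ r, (t * (ν r).choose 2 + r * ν r)) * ∏ r, (qPoch (q ^ t) (ν r))⁻¹ =
    q ^ N.choose 2 * (qPoch q N)⁻¹ := by
  have h := congrArg (PowerSeries.coeff N) (prod_rescale_eulerSeries hq ht)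
  rw [PowerSeries.coeff_prod] at h
  simp only [PowerSeries.coeff_rescale, eulerSeries, PowerSeries.coeff_mk] at h
  rw [← h]
  refine Finset.sum_congr rfl fun ν _ => ?_
  rw [← Finset.prod_pow_eq_pow_sum, ← Finset.prod_mul_distrib]
  refine Finset.prod_congr rfl fun r _ => ?_
  rw [pow_add, pow_mul, pow_mul]
  ring

end QBinomial

section Abacus

/-- The bead set on the `t`-runner abacus with `ν r` beads pushed up on each runner `r`. -/
def flushBeads {t : ℕ} (ν : Fin t → ℕ) : Finset ℕ :=
  (Finset.univ.sigma fun r => Finset.range (ν r)).image fun a : (_ : Fin t) × ℕ => t * a.2 + a.1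

/-- The number of beads on each runner of the `t`-runner abacus. -/
def runnerCount (t : ℕ) (B : Finset ℕ) (r : Fin t) : ℕ := (B.filter fun b => b % t = r).card

lemma mul_add_fin_injective (t : ℕ) :
    Function.Injective fun a : (_ : Fin t) × ℕ => t * a.2 + a.1 := by
  rintro ⟨r, k⟩ ⟨s, l⟩ h
  have ht : 0 < t := r.pos
  have h1 := congrArg (· % t) h
  have h2 := congrArg (· / t) h
  simp only [Nat.mul_add_mod, Nat.mod_eq_of_lt r.2, Nat.mod_eq_of_lt s.2] at h1
  simp only [Nat.mul_add_div ht, Nat.div_eq_of_lt r.2, Nat.div_eq_of_lt s.2] at h2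
  obtain rfl := Fin.ext h1
  simp_all

lemma mem_flushBeads {t : ℕ} (ν : Fin t → ℕ) (r : Fin t) (k : ℕ) :
    t * k + r ∈ flushBeads ν ↔ k < ν r := by
  rw [flushBeads]
  have := (mul_add_fin_injective t).mem_finset_image
    (s := Finset.univ.sigma fun r => Finset.range (ν r)) (a := ⟨r, k⟩)
  simpa using this

lemma exists_eq_mul_add {t : ℕ} (ht : 0 < t) (x : ℕ) : ∃ (r : Fin t) (k : ℕ), x = t * k + r :=
  ⟨⟨x % t, Nat.mod_lt x ht⟩, x / t, (Nat.div_add_mod x t).symm⟩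

lemma sub_mem_flushBeads {t : ℕ} (ht : 0 < t) (ν : Fin t → ℕ) :
    ∀ b ∈ flushBeads ν, t ≤ b → b - t ∈ flushBeads ν := by
  intro b hb htb
  obtain ⟨r, k, rfl⟩ := exists_eq_mul_add ht b
  rw [mem_flushBeads] at hb
  obtain _ | k := k
  · have := r.2
    omega
  · have : t * (k + 1) + r - t = t * k + r := by rw [mul_add]; omega
    rw [this, mem_flushBeads]
    omega

lemma card_flushBeads {t : ℕ} (ν : Fin t → ℕ) : (flushBeads ν).card = ∑ r, ν r := by
  simp [flushBeads, Finset.card_image_of_injective _ (mul_add_fin_injective t)]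

lemma sum_flushBeads {t : ℕ} (ν : Fin t → ℕ) :
    ∑ b ∈ flushBeads ν, b = ∑ r, (t * (ν r).choose 2 + r * ν r) := by
  rw [flushBeads, Finset.sum_image (mul_add_fin_injective t).injOn, Finset.sum_sigma]
  refine Finset.sum_congr rfl fun r _ => ?_
  rw [Finset.sum_add_distrib, ← Finset.mul_sum, Finset.sum_range_id, Nat.choose_two_right]
  simp [mul_comm]

lemma filter_mod_eq_image {t : ℕ} (B : Finset ℕ) (r : Fin t) :
    (B.filter fun b => b % t = r) =
      ((B.filter fun b => b % t = r).image (· / t)).image fun k => t * k + r := by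
  ext x
  simp only [Finset.mem_image, Finset.mem_filter, exists_exists_and_eq_and]
  constructor
  · rintro ⟨hx, hr⟩
    exact ⟨x, ⟨hx, hr⟩, by rw [← hr, Nat.div_add_mod]⟩
  · rintro ⟨y, ⟨hy, hr⟩, rfl⟩
    rw [← hr, Nat.div_add_mod]
    exact ⟨hy, rfl⟩

lemma runnerCount_eq_card_image {t : ℕ} (ht : 0 < t) (B : Finset ℕ) (r : Fin t) :
    runnerCount t B r = ((B.filter fun b => b % t = r).image (· / t)).card := by
  rw [runnerCount, filter_mod_eq_image B r, Finset.card_image_of_injective]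
  · rw [← filter_mod_eq_image B r]
  · intro a b h
    exact Nat.eq_of_mul_eq_mul_left ht (Nat.add_right_cancel h)

lemma mem_image_div {t : ℕ} (ht : 0 < t) (B : Finset ℕ) (r : Fin t) (k : ℕ) :
    k ∈ (B.filter fun b => b % t = r).image (· / t) ↔ t * k + r ∈ B := by
  simp only [Finset.mem_image, Finset.mem_filter]
  constructor
  · rintro ⟨y, ⟨hy, hr⟩, rfl⟩
    rwa [← hr, Nat.div_add_mod]
  · intro h
    exact ⟨_, ⟨h, by rw [Nat.mul_add_mod, Nat.mod_eq_of_lt r.2]⟩,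
      by rw [Nat.mul_add_div ht, Nat.div_eq_of_lt r.2, add_zero]⟩

lemma eq_range_card_of_forall_succ {D : Finset ℕ} (h : ∀ k, k + 1 ∈ D → k ∈ D) :
    D = Finset.range D.card := by
  have hdown : ∀ k ∈ D, ∀ j, j ≤ k → j ∈ D := by
    intro k
    induction k with
    | zero => intro hk j hj; obtain rfl := Nat.le_zero.1 hj; exact hk
    | succ k ih =>
      intro hk j hj
      rcases Nat.lt_or_ge j (k + 1) with hlt | hge
      · exact ih (h k hk) j (Nat.lt_succ_iff.1 hlt)
      · rwa [le_antisymm hj hge]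
  refine Finset.eq_of_subset_of_card_le (fun k hk => ?_) (by simp)
  have hsub : Finset.range (k + 1) ⊆ D := fun j hj =>
    hdown k hk j (Nat.lt_succ_iff.1 (Finset.mem_range.1 hj))
  have := Finset.card_le_card hsub
  rw [Finset.card_range] at this
  exact Finset.mem_range.2 this

lemma flushBeads_runnerCount {t : ℕ} (ht : 0 < t) {B : Finset ℕ}
    (hB : ∀ b ∈ B, t ≤ b → b - t ∈ B) : flushBeads (runnerCount t B) = B := by
  ext x
  obtain ⟨r, k, rfl⟩ := exists_eq_mul_add ht x
  rw [mem_flushBeads, runnerCount_eq_card_image ht, ← Finset.mem_range, ← eq_range_card_of_forall_succ,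
    mem_image_div ht]
  intro k hk
  rw [mem_image_div ht] at hk ⊢
  have := hB _ hk (by rw [mul_add]; omega)
  rwa [show t * (k + 1) + r - t = t * k + r by rw [mul_add]; omega] at this

lemma runnerCount_flushBeads {t : ℕ} (ht : 0 < t) (ν : Fin t → ℕ) :
    runnerCount t (flushBeads ν) = ν := by
  funext r
  rw [runnerCount_eq_card_image ht, show ((flushBeads ν).filter fun b => b % t = r).image (· / t) =
    Finset.range (ν r) from ?_, Finset.card_range]
  ext k
  rw [mem_image_div ht, mem_flushBeads, Finset.mem_range]

lemma sum_runnerCount {t : ℕ} (ht : 0 < t) (B : Finset ℕ) :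
    ∑ r, runnerCount t B r = B.card := by
  rw [Finset.card_eq_sum_card_fiberwise (f := fun b => (⟨b % t, Nat.mod_lt b ht⟩ : Fin t))
    (t := Finset.univ) (by simp [Set.MapsTo])]
  simp [runnerCount, Fin.ext_iff]

end Abacus

section Beads

/-- The `i`-th largest part of a partition, `0` beyond the last part. -/
def partAt {n : ℕ} (p : n.Partition) (i : ℕ) : ℕ := (sortedParts p).getD i 0

lemma coe_sortedParts {n : ℕ} (p : n.Partition) : (sortedParts p : Multiset ℕ) = p.parts :=
  Multiset.sort_eq _ _

lemma length_sortedParts {n : ℕ} (p : n.Partition) : (sortedParts p).length = p.parts.card := by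
  rw [← coe_sortedParts, Multiset.coe_card]

lemma lt_getD_iff_lt_countP {l : List ℕ} (hl : l.Pairwise (· ≥ ·)) (i j : ℕ) :
    j < l.getD i 0 ↔ i < l.countP (j < ·) := by
  induction l generalizing i with
  | nil => simp
  | cons a l ih =>
    rw [List.pairwise_cons] at hl
    by_cases ha : j < a
    · cases i with
      | zero => simp [ha]
      | succ i => simpa [ha] using ih hl.2 i
    · have h0 : l.countP (j < ·) = 0 := by
        rw [List.countP_eq_zero]
        intro b hb
        have := hl.1 b hb
        simp only [decide_eq_true_eq]
        omega
      cases i with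
      | zero => simp [ha, h0]
      | succ i =>
        have := ih hl.2 i
        simp only [List.getD_cons_succ, this, h0]
        simp [ha, h0]

lemma lt_partAt_iff {n : ℕ} (p : n.Partition) (i j : ℕ) :
    j < partAt p i ↔ i < (p.parts.filter fun x => j < x).card := by
  have hsort : (sortedParts p).Pairwise (· ≥ ·) := Multiset.pairwise_sort _ _
  rw [partAt, lt_getD_iff_lt_countP hsort, ← coe_sortedParts,
    ← Multiset.countP_eq_card_filter, Multiset.coe_countP]

lemma partAt_antitone {n : ℕ} (p : n.Partition) : Antitone (partAt p) := by
  intro i i' h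
  by_contra! hlt
  rw [lt_partAt_iff] at hlt
  exact lt_irrefl _ ((lt_partAt_iff p i _).2 (h.trans_lt hlt))

lemma partAt_pos_iff {n : ℕ} (p : n.Partition) (i : ℕ) : 0 < partAt p i ↔ i < p.parts.card := by
  rw [lt_partAt_iff, Multiset.filter_eq_self.2 fun _ => p.parts_pos]

lemma partAt_eq_zero {n : ℕ} (p : n.Partition) {i : ℕ} (h : p.parts.card ≤ i) :
    partAt p i = 0 := by
  have := partAt_pos_iff p i
  omega

lemma sum_range_getD (l : List ℕ) {N : ℕ} (h : l.length ≤ N) :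
    ∑ i ∈ Finset.range N, l.getD i 0 = l.sum := by
  induction l generalizing N with
  | nil => simp
  | cons a l ih =>
    obtain _ | N := N
    · simp at h
    · rw [Finset.sum_range_succ']
      simp only [List.getD_cons_succ, List.getD_cons_zero, List.sum_cons]
      rw [ih (by simpa using h), add_comm]

lemma sum_range_partAt {n : ℕ} (p : n.Partition) {N : ℕ} (h : p.parts.card ≤ N) :
    ∑ i ∈ Finset.range N, partAt p i = n := by
  simp only [partAt]
  rw [sum_range_getD _ ((length_sortedParts p).trans_le h), ← Multiset.sum_coe, coe_sortedParts,
    p.parts_sum]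

lemma parts_eq_of_partAt_eq {n m : ℕ} {p : n.Partition} {p' : m.Partition}
    (h : ∀ i, partAt p i = partAt p' i) : p.parts = p'.parts := by
  have hlen : p.parts.card = p'.parts.card := by
    have h' : ∀ i, i < p.parts.card ↔ i < p'.parts.card := fun i => by
      rw [← partAt_pos_iff, ← partAt_pos_iff, h]
    exact le_antisymm (not_lt.1 fun hl => lt_irrefl _ ((h' _).1 hl))
      (not_lt.1 fun hl => lt_irrefl _ ((h' _).2 hl))
  rw [← coe_sortedParts p, ← coe_sortedParts p']
  congr 1
  refine List.ext_getElem (by rw [length_sortedParts, length_sortedParts, hlen]) ?_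
  intro i h₁ h₂
  have := h i
  rwa [partAt, partAt, List.getD_eq_getElem _ _ h₁, List.getD_eq_getElem _ _ h₂] at this

lemma exists_partition_partAt_eq {f : ℕ → ℕ} (hf : Antitone f) {N : ℕ} (hN : f N = 0) :
    ∃ (n : ℕ) (p : n.Partition), (∀ i, partAt p i = f i) ∧ p.parts.card ≤ N := by
  classical
  have hex : ∃ m, f m = 0 := ⟨N, hN⟩
  set m := Nat.find hex with hm
  have hpos : ∀ i < m, 0 < f i := fun i hi => Nat.pos_of_ne_zero (Nat.find_min hex hi)
  have hzero : ∀ i, m ≤ i → f i = 0 := fun i hi =>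
    Nat.le_zero.1 ((hf hi).trans (Nat.find_spec hex).le)
  set l := (List.range m).map f with hl
  have hsort : l.Pairwise (· ≥ ·) :=
    List.pairwise_map.2 (List.pairwise_lt_range.imp fun h => hf h.le)
  let p : Nat.Partition l.sum := ⟨(l : Multiset ℕ), by
    intro i hi
    rw [Multiset.mem_coe, hl, List.mem_map] at hi
    obtain ⟨k, hk, rfl⟩ := hi
    exact hpos k (List.mem_range.1 hk), Multiset.sum_coe l⟩
  have hp : sortedParts p = l :=
    (Multiset.coe_sort l (· ≥ ·)).trans (List.mergeSort_eq_self _ hsort)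
  refine ⟨l.sum, p, fun i => ?_, ?_⟩
  · rw [partAt, hp, hl]
    rcases Nat.lt_or_ge i m with hi | hi
    · rw [List.getD_eq_getElem _ _ (by simpa using hi)]
      simp
    · rw [List.getD_eq_default _ _ (by simpa using hi), hzero i hi]
  · have : p.parts.card = m := by
      rw [← length_sortedParts, hp, hl, List.length_map, List.length_range]
    rw [this]
    exact Nat.find_min' hex hN

/-- The `N`-bead set of a partition with at most `N` parts: `N` distinct naturals from which the
parts are recovered by subtracting `0, 1, …, N - 1` in increasing order. -/
def beads {n : ℕ} (p : n.Partition) (N : ℕ) : Finset ℕ :=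
  (Finset.range N).image fun j => partAt p (N - 1 - j) + j

lemma strictMono_partAt_add {n : ℕ} (p : n.Partition) (N : ℕ) :
    StrictMono fun j => partAt p (N - 1 - j) + j := fun _ _ h =>
  add_lt_add_of_le_of_lt (partAt_antitone p (Nat.sub_le_sub_left h.le _)) h

lemma card_beads {n : ℕ} (p : n.Partition) (N : ℕ) : (beads p N).card = N := by
  rw [beads, Finset.card_image_of_injective _ (strictMono_partAt_add p N).injective,
    Finset.card_range]

lemma sum_beads {n : ℕ} (p : n.Partition) {N : ℕ} (h : p.parts.card ≤ N) :
    ∑ b ∈ beads p N, b = n + N.choose 2 := by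
  rw [beads, Finset.sum_image (strictMono_partAt_add p N).injective.injOn,
    Finset.sum_add_distrib, Finset.sum_range_reflect (partAt p) N, sum_range_partAt p h,
    Finset.sum_range_id, Nat.choose_two_right]

lemma mem_beads {n : ℕ} (p : n.Partition) (N x : ℕ) :
    x ∈ beads p N ↔ ∃ i < N, partAt p i + (N - 1 - i) = x := by
  rw [beads, Finset.mem_image]
  constructor
  · rintro ⟨j, hj, rfl⟩
    rw [Finset.mem_range] at hj
    exact ⟨N - 1 - j, by omega, by rw [show N - 1 - (N - 1 - j) = j by omega]⟩
  · rintro ⟨i, hi, rfl⟩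
    exact ⟨N - 1 - i, by rw [Finset.mem_range]; omega,
      by rw [show N - 1 - (N - 1 - i) = i by omega]⟩

lemma partAt_add_eq_orderEmbOfFin {n : ℕ} (p : n.Partition) {N : ℕ} (j : Fin N) :
    partAt p (N - 1 - j) + j = (beads p N).orderEmbOfFin (card_beads p N) j := by
  refine congrFun (Finset.orderEmbOfFin_unique (card_beads p N)
    (f := fun j : Fin N => partAt p (N - 1 - j) + j) (fun j => ?_) fun i j h => ?_) j
  · exact Finset.mem_image_of_mem _ (Finset.mem_range.2 j.2)
  · exact strictMono_partAt_add p N h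

lemma parts_eq_of_beads_eq {n m N : ℕ} {p : n.Partition} {p' : m.Partition}
    (hp : p.parts.card ≤ N) (hp' : p'.parts.card ≤ N) (h : beads p N = beads p' N) :
    p.parts = p'.parts := by
  refine parts_eq_of_partAt_eq fun i => ?_
  rcases Nat.lt_or_ge i N with hi | hi
  · have h1 := partAt_add_eq_orderEmbOfFin p (⟨N - 1 - i, by omega⟩ : Fin N)
    have h2 := partAt_add_eq_orderEmbOfFin p' (⟨N - 1 - i, by omega⟩ : Fin N)
    simp only [h, show N - 1 - (N - 1 - i) = i by omega] at h1 h2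
    omega
  · rw [partAt_eq_zero p (hp.trans hi), partAt_eq_zero p' (hp'.trans hi)]

lemma exists_beads_eq {B : Finset ℕ} {N : ℕ} (hB : B.card = N) :
    ∃ (n : ℕ) (p : n.Partition), p.parts.card ≤ N ∧ beads p N = B := by
  set b := B.orderEmbOfFin hB with hb
  have hgap : ∀ d i (hi : i + d < N), b ⟨i, by omega⟩ + d ≤ b ⟨i + d, hi⟩ := by
    intro d
    induction d with
    | zero => intro i hi; exact le_rfl
    | succ d ih =>
      intro i hi
      have h1 := ih i (by omega)
      have h2 : b ⟨i + d, by omega⟩ < b ⟨i + (d + 1), hi⟩ :=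
        b.strictMono (Fin.mk_lt_mk.2 (by omega))
      omega
  have hge : ∀ i (hi : i < N), i ≤ b ⟨i, hi⟩ := by
    intro i hi
    have := hgap i 0 (by omega)
    simp only [zero_add] at this
    omega
  let f : ℕ → ℕ := fun i => if h : i < N then b ⟨N - 1 - i, by omega⟩ - (N - 1 - i) else 0
  have hf : Antitone f := by
    intro i j hij
    rcases Nat.lt_or_ge j N with hj | hj
    · have hi : i < N := by omega
      simp only [f, hi, hj, dif_pos]
      have := hgap (j - i) (N - 1 - j) (by omega)
      simp only [show N - 1 - j + (j - i) = N - 1 - i by omega] at this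
      omega
    · simp [f, hj.not_gt]
  obtain ⟨n, p, hpf, hcard⟩ := exists_partition_partAt_eq hf (N := N) (by simp [f])
  refine ⟨n, p, hcard, Finset.eq_of_subset_of_card_le ?_ (by rw [card_beads, hB])⟩
  intro x hx
  obtain ⟨i, hi, rfl⟩ := (mem_beads p N x).1 hx
  have := hge (N - 1 - i) (by omega)
  rw [hpf]
  simp only [f, hi, dif_pos, Nat.sub_add_cancel this]
  exact Finset.orderEmbOfFin_mem B hB _

lemma isTCore_iff_sub_mem_beads {t n N : ℕ} (p : n.Partition) (hN : p.parts.card ≤ N) :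
    IsTCore t p ↔ ∀ b ∈ beads p N, t ≤ b → b - t ∈ beads p N := by
  constructor
  · intro hcore b hb htb
    obtain ⟨i, hi, rfl⟩ := (mem_beads p N b).1 hb
    by_contra hy
    set y := partAt p i + (N - 1 - i) - t with hydef
    have hzero := partAt_eq_zero p hN
    have hex : ∃ k, N ≤ k ∨ partAt p k + (N - 1 - k) < y := ⟨N, Or.inl le_rfl⟩
    classical
    obtain ⟨k, hk, hmin⟩ : ∃ k, (N ≤ k ∨ partAt p k + (N - 1 - k) < y) ∧
        ∀ l < k, l < N ∧ y < partAt p l + (N - 1 - l) := by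
      refine ⟨Nat.find hex, Nat.find_spec hex, fun l hl => ?_⟩
      have h1 := Nat.find_min hex hl
      have h2 : partAt p l + (N - 1 - l) = y → N ≤ l := fun h => by
        by_contra! hlN
        exact hy ((mem_beads p N y).2 ⟨l, hlN, h⟩)
      omega
    have hkN : k ≤ N := by
      by_contra! h
      exact absurd (hmin N h).1 (lt_irrefl N)
    have hky : N - k ≤ y := by omega
    have hconj : (p.parts.filter fun x => y - (N - k) < x).card = k := by
      refine le_antisymm (not_lt.1 fun h => ?_) (not_lt.1 fun h => ?_)
      · rw [← lt_partAt_iff] at h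
        rcases hk with hk | hk
        · obtain rfl : k = N := by omega
          omega
        · omega
      · have h1 := hmin (k - 1) (by omega)
        have h2 := (lt_partAt_iff p (k - 1) (y - (N - k))).1 (by omega)
        omega
    have hik : i < k := by
      by_contra! h
      have := partAt_antitone p h
      omega
    have hj : y - (N - k) < partAt p i := (lt_partAt_iff p i _).2 (by rwa [hconj])
    refine hcore i (y - (N - k)) hj ?_
    rw [hookLen, hconj]
    change ((partAt p i : ℕ) : ℤ) + _ - _ - _ - _ = _
    omega
  · intro hclosed i j hj hhook
    have hj' : j < partAt p i := hj
    rw [hookLen] at hhook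
    change ((partAt p i : ℕ) : ℤ) + _ - _ - _ - _ = _ at hhook
    have hik := (lt_partAt_iff p i j).1 hj'
    have hkN : (p.parts.filter fun x => j < x).card ≤ N :=
      (Multiset.card_le_card (Multiset.filter_le _ _)).trans hN
    have hconj := fun l => lt_partAt_iff p l j
    set k := (p.parts.filter fun x => j < x).card
    obtain ⟨m, hm, hmeq⟩ := (mem_beads p N _).1
      (hclosed _ ((mem_beads p N _).2 ⟨i, by omega, rfl⟩) (by omega))
    have := hconj m
    omega

end Beads

section CorePartitions

/-- The type of all `t`-core partitions, of arbitrary size. -/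
abbrev CorePartition (t : ℕ) : Type := Σ n : ℕ, {p : n.Partition // IsTCore t p}

lemma CorePartition.ext_parts {t : ℕ} {c d : CorePartition t} (h : c.2.1.parts = d.2.1.parts) :
    c = d := by
  obtain ⟨n, p, hp⟩ := c
  obtain ⟨m, p', hp'⟩ := d
  obtain rfl : n = m := by rw [← p.parts_sum, ← p'.parts_sum]; exact congrArg Multiset.sum h
  obtain rfl : p = p' := Nat.Partition.ext h
  rfl

lemma exists_corePartition_beads_eq {t : ℕ} (ht : 0 < t) (ν : Fin t → ℕ) :
    ∃ c : CorePartition t, c.2.1.parts.card ≤ ∑ r, ν r ∧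
      beads c.2.1 (∑ r, ν r) = flushBeads ν := by
  obtain ⟨n, p, hp, hB⟩ := exists_beads_eq (card_flushBeads ν)
  refine ⟨⟨n, p, (isTCore_iff_sub_mem_beads p hp).2 ?_⟩, hp, hB⟩
  rw [hB]
  exact sub_mem_flushBeads ht ν

lemma hasSum_corePartition {K : Type*} [Field K] [TopologicalSpace K] {q : K} (hq0 : q ≠ 0)
    (hq : ∀ n : ℕ, q ^ (n + 1) ≠ 1) {t : ℕ} (ht : 0 < t) (N : ℕ) :
    HasSum (fun c : CorePartition t => if c.2.1.parts.card ≤ N then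
      q ^ c.1 * ∏ r, (qPoch (q ^ t) (runnerCount t (beads c.2.1 N) r))⁻¹ else 0)
      (qPoch q N)⁻¹ := by
  choose c hc hcB using exists_corePartition_beads_eq ht
  let g : {ν // ν ∈ (Finset.univ : Finset (Fin t)).finsuppAntidiag N} → CorePartition t :=
    fun ν => c ν.1
  have hsum : ∀ ν : {ν // ν ∈ (Finset.univ : Finset (Fin t)).finsuppAntidiag N},
      ∑ r, ν.1 r = N := fun ν => (Finset.mem_finsuppAntidiag.1 ν.2).1
  have hgc : ∀ ν, (g ν).2.1.parts.card ≤ N := fun ν => (hc ν.1).trans_eq (hsum ν)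
  have hgB : ∀ ν, beads (g ν).2.1 N = flushBeads ν.1 := fun ν => by
    rw [← hcB ν.1, hsum ν]
  have hg : Function.Injective g := fun ν μ h => by
    refine Subtype.ext (DFunLike.coe_injective ?_)
    rw [← runnerCount_flushBeads ht ν.1, ← runnerCount_flushBeads ht μ.1, ← hgB, ← hgB, h]
  rw [← hg.hasSum_iff]
  · convert hasSum_fintype _ using 1
    refine mul_left_cancel₀ (pow_ne_zero (N.choose 2) hq0) ?_
    rw [← sum_prod_inv_qPoch hq ht, ← Finset.sum_coe_sort, Finset.mul_sum]
    refine Finset.sum_congr rfl fun ν _ => ?_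
    have hsize := sum_beads _ (hgc ν)
    rw [hgB, sum_flushBeads] at hsize
    rw [Function.comp_apply, if_pos (hgc ν), hgB, runnerCount_flushBeads ht, hsize, pow_add]
    ring
  · intro d hd
    refine if_neg fun hdN => hd ?_
    have hflush := flushBeads_runnerCount ht ((isTCore_iff_sub_mem_beads _ hdN).1 d.2.2)
    let ν : Fin t →₀ ℕ := Finsupp.equivFunOnFinite.symm (runnerCount t (beads d.2.1 N))
    have hν : ν ∈ (Finset.univ : Finset (Fin t)).finsuppAntidiag N :=
      Finset.mem_finsuppAntidiag.2
        ⟨(sum_runnerCount ht _).trans (card_beads _ N), Finset.subset_univ _⟩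
    exact ⟨⟨ν, hν⟩, CorePartition.ext_parts
      (parts_eq_of_beads_eq (hgc _) hdN ((hgB ⟨ν, hν⟩).trans hflush))⟩

lemma tendsto_runnerCount_beads {t n : ℕ} (p : n.Partition) (r : Fin t) :
    Filter.Tendsto (fun N => runnerCount t (beads p N) r) Filter.atTop Filter.atTop := by
  have ht : 0 < t := r.pos
  rw [Filter.tendsto_atTop]
  intro m
  filter_upwards [Filter.eventually_ge_atTop (t * m + p.parts.card)] with N hN
  rw [runnerCount_eq_card_image ht]
  have hsub : Finset.range m ⊆ ((beads p N).filter fun b => b % t = r).image (· / t) := by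
    intro k hk
    rw [mem_image_div ht, mem_beads]
    have h1 : t * (k + 1) ≤ t * m := Nat.mul_le_mul_left t (Finset.mem_range.1 hk)
    rw [mul_add, mul_one] at h1
    have h2 := r.2
    refine ⟨N - 1 - (t * k + r), by omega, ?_⟩
    rw [partAt_eq_zero p (by omega)]
    omega
  simpa using Finset.card_le_card hsub

end CorePartitions

section Limits

variable {K : Type*} [NormedField K]

lemma pow_succ_ne_one_of_norm_lt_one {q : K} (hq : ‖q‖ < 1) (n : ℕ) : q ^ (n + 1) ≠ 1 := by
  intro h
  have := pow_lt_one₀ (norm_nonneg q) hq n.succ_ne_zero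
  rw [← norm_pow, h, norm_one] at this
  exact lt_irrefl _ this

lemma summable_norm_neg_pow_succ {q : K} (hq : ‖q‖ < 1) :
    Summable fun n : ℕ => ‖-q ^ (n + 1)‖ := by
  simp only [norm_neg, norm_pow]
  exact (summable_nat_add_iff 1).2 (summable_geometric_of_lt_one (norm_nonneg q) hq)

variable [CompleteSpace K]

lemma tendsto_qPoch {q : K} (hq : ‖q‖ < 1) :
    Filter.Tendsto (qPoch q) Filter.atTop (nhds (∏' n : ℕ, (1 - q ^ (n + 1)))) := by
  have h := multipliable_one_add_of_summable (f := fun n : ℕ => -q ^ (n + 1))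
    (summable_norm_neg_pow_succ hq)
  simp only [← sub_eq_add_neg] at h
  exact h.tendsto_prod_tprod_nat

lemma tprod_one_sub_pow_ne_zero {q : K} (hq : ‖q‖ < 1) : ∏' n : ℕ, (1 - q ^ (n + 1)) ≠ 0 := by
  simp only [sub_eq_add_neg]
  refine tprod_one_add_ne_zero_of_summable (fun n => ?_) (summable_norm_neg_pow_succ hq)
  rw [← sub_eq_add_neg]
  exact sub_ne_zero.2 (pow_succ_ne_one_of_norm_lt_one hq n).symm

lemma tendsto_inv_qPoch {q : K} (hq : ‖q‖ < 1) :
    Filter.Tendsto (fun N => (qPoch q N)⁻¹) Filter.atTop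
      (nhds (∏' n : ℕ, (1 - q ^ (n + 1)))⁻¹) :=
  (tendsto_qPoch hq).inv₀ (tprod_one_sub_pow_ne_zero hq)

lemma one_le_inv_qPoch {x : ℝ} (hx0 : 0 ≤ x) (hx : x < 1) (N : ℕ) : 1 ≤ (qPoch x N)⁻¹ := by
  refine (one_le_inv₀ (Finset.prod_pos fun n _ => ?_)).2
    (Finset.prod_le_one (fun n _ => ?_) fun n _ => ?_)
  · exact sub_pos.2 (pow_lt_one₀ hx0 hx n.succ_ne_zero)
  · exact sub_nonneg.2 (pow_lt_one₀ hx0 hx n.succ_ne_zero).le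
  · exact sub_le_self _ (pow_nonneg hx0 _)

lemma summable_corePartition {x : ℝ} (hx0 : 0 < x) (hx : x < 1) {t : ℕ} (ht : 0 < t) :
    Summable fun c : CorePartition t => x ^ c.1 := by
  have hnorm : ‖x‖ < 1 := by rwa [Real.norm_of_nonneg hx0.le]
  obtain ⟨C, hC⟩ := (tendsto_inv_qPoch hnorm).bddAbove_range
  have hxt : x ^ t < 1 := pow_lt_one₀ hx0.le hx ht.ne'
  have hprod : ∀ (c : CorePartition t) (N : ℕ),
      1 ≤ ∏ r, (qPoch (x ^ t) (runnerCount t (beads c.2.1 N) r))⁻¹ := fun c N =>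
    Finset.one_le_prod fun r _ => one_le_inv_qPoch (pow_nonneg hx0.le t) hxt _
  refine summable_of_sum_le (c := C) (fun c => pow_nonneg hx0.le _) fun s => ?_
  set N := s.sup fun c => c.2.1.parts.card with hN
  have hsum := hasSum_corePartition hx0.ne' (pow_succ_ne_one_of_norm_lt_one hnorm) ht N
  refine le_trans ?_ ((sum_le_hasSum s (fun c _ => ?_) hsum).trans (hC ⟨N, rfl⟩))
  · refine Finset.sum_le_sum fun c hc => ?_
    rw [if_pos (Finset.le_sup (f := fun c : CorePartition t => c.2.1.parts.card) hc)]
    exact le_mul_of_one_le_right (pow_nonneg hx0.le _) (hprod c N)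
  · split_ifs
    · exact mul_nonneg (pow_nonneg hx0.le _) (zero_le_one.trans (hprod c N))
    · exact le_rfl

lemma tsum_corePartition {q : K} (hq0 : q ≠ 0) (hq : ‖q‖ < 1) {t : ℕ} (ht : 0 < t) :
    (∏' n : ℕ, (1 - (q ^ t) ^ (n + 1))) ^ t / ∏' n : ℕ, (1 - q ^ (n + 1)) =
      ∑' c : CorePartition t, q ^ c.1 := by
  have hqt : ‖q ^ t‖ < 1 := by
    rw [norm_pow]
    exact pow_lt_one₀ (norm_nonneg q) hq ht.ne'
  obtain ⟨C, hC⟩ := (tendsto_inv_qPoch hqt).norm.bddAbove_range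
  have hC' : ∀ N, ‖(qPoch (q ^ t) N)⁻¹‖ ≤ C := fun N => hC ⟨N, rfl⟩
  have hC0 : 0 ≤ C := (norm_nonneg _).trans (hC' 0)
  have hlim := tendsto_tsum_of_dominated_convergence (𝓕 := Filter.atTop)
    (f := fun (N : ℕ) (c : CorePartition t) => if c.2.1.parts.card ≤ N then
      q ^ c.1 * ∏ r, (qPoch (q ^ t) (runnerCount t (beads c.2.1 N) r))⁻¹ else 0)
    (g := fun c => q ^ c.1 * ∏ _r : Fin t, (∏' n : ℕ, (1 - (q ^ t) ^ (n + 1)))⁻¹)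
    ((summable_corePartition (norm_pos_iff.2 hq0) hq ht).mul_right (C ^ t)) ?_ ?_
  · simp only [fun N => (hasSum_corePartition hq0 (pow_succ_ne_one_of_norm_lt_one hq) ht N).tsum_eq]
      at hlim
    have h := tendsto_nhds_unique hlim (tendsto_inv_qPoch hq)
    rw [tsum_mul_right, Finset.prod_const, Finset.card_univ, Fintype.card_fin] at h
    have hne := pow_ne_zero t (tprod_one_sub_pow_ne_zero hqt)
    rw [div_eq_mul_inv, ← h, inv_pow]
    field_simp
  · intro c
    refine Filter.Tendsto.congr' ?_ ((tendsto_finsetProd _ fun r _ =>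
      (tendsto_inv_qPoch hqt).comp (tendsto_runnerCount_beads c.2.1 r)).const_mul (q ^ c.1))
    filter_upwards [Filter.eventually_ge_atTop c.2.1.parts.card] with N hN
    rw [if_pos hN]
    rfl
  · refine Filter.Eventually.of_forall fun N c => ?_
    split_ifs
    · rw [norm_mul, norm_pow, norm_prod]
      refine mul_le_mul_of_nonneg_left ?_ (by positivity)
      refine (Finset.prod_le_prod (fun _ _ => norm_nonneg _) fun r _ => hC' _).trans_eq ?_
      rw [Finset.prod_const, Finset.card_univ, Fintype.card_fin]
    · rw [norm_zero]
      positivity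

end Limits

lemma tsum_corePartition_eq_tsum_card {q : ℂ} (hq0 : q ≠ 0) (hq : ‖q‖ < 1) {t : ℕ} (ht : 0 < t) :
    ∑' c : CorePartition t, q ^ c.1 =
      ∑' n : ℕ, (Nat.card {p : n.Partition // IsTCore t p} : ℂ) * q ^ n := by
  have hs : Summable fun c : CorePartition t => q ^ c.1 := by
    refine Summable.of_norm ?_
    simpa only [norm_pow] using summable_corePartition (norm_pos_iff.2 hq0) hq ht
  rw [hs.tsum_sigma]
  refine tsum_congr fun n => ?_
  rw [← nsmul_eq_mul]
  exact tsum_const (q ^ n)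

lemma card_tCore_zero {t : ℕ} : Nat.card {p : Nat.Partition 0 // IsTCore t p} = 1 := by
  have hcore : ∀ p : Nat.Partition 0, IsTCore t p := fun p i j h => by
    have : partAt p i = 0 := partAt_eq_zero p (by simp)
    exact absurd h (by rw [partAt] at this; omega)
  rw [Nat.card_congr (Equiv.subtypeUnivEquiv hcore), Nat.card_unique]

/-- For every positive integer `t`, `E(q^t)^t / E(q) = ∑ₙ a_t(n) qⁿ`, where
`a_t(n)` is the (nonnegative) number of `t`-core partitions of `n`. -/
theorem Eprod_pow_div_Eprod_eq_tcore_generating_function (t : ℕ) (ht : 0 < t) :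
    ∃ a : ℕ → ℕ,
      (∀ n : ℕ, a n = Nat.card {p : n.Partition // IsTCore t p}) ∧
      ∀ q : ℂ, ‖q‖ < 1 →
        Eprod (q ^ t) ^ t / Eprod q = ∑' n : ℕ, (a n : ℂ) * q ^ n := by
  refine ⟨fun n => Nat.card {p : n.Partition // IsTCore t p}, fun n => rfl, fun q hq => ?_⟩
  rcases eq_or_ne q 0 with rfl | hq0
  · have hE : Eprod 0 = 1 := by simp [Eprod]
    rw [zero_pow ht.ne', hE, tsum_eq_single 0 fun n hn => by simp [hn]]
    simp [card_tCore_zero]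
  · rw [← tsum_corePartition_eq_tsum_card hq0 hq ht]
    exact tsum_corePartition hq0 hq ht
end

section
/- Let a ≥ 2 be an integer, z a nonzero complex number, and |q| < 1. Then ∑_{n ∈ ℤ^a, n·1=0} q^{(a/2) n·n + b_a·n} ∑_{j=0}^{a-1} z^{a n_j + j} = E(q) E(q^a)^{a-2} ∏_{n=1}^∞ (1-z^a q^{a(n-1)})(1-z^{-a} q^{an}) / ((1-z q^{n-1})(1-z^{-1} q^n)), where b_a = (0,1,...,a-1) and E(q) = ∏_{n≥1}(1-q^n). -/
open Filter Topology

/-- The coefficient `(-1)ᵏ q^{k(k-1)/2}` of `zᵏ` in Jacobi's theta series. -/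
noncomputable def thetaCoeff (q : ℂ) (k : ℤ) : ℂ := (-1) ^ k * q ^ (k * (k - 1) / 2)

/-- The reciprocal of the finite `q`-Pochhammer symbol `(q; q)_m`, extended by `0` to `m < 0`. -/
noncomputable def qPochRecip (q : ℂ) : ℤ → ℂ
  | .ofNat m => (∏ i ∈ Finset.range m, (1 - q ^ (i + 1)))⁻¹
  | .negSucc _ => 0

theorem Int.mul_sub_one_ediv_two_add_one (k : ℤ) :
    (k + 1) * (k + 1 - 1) / 2 = k * (k - 1) / 2 + k := by
  rw [show (k + 1) * (k + 1 - 1) = k * (k - 1) + k * 2 by ring,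
    Int.add_mul_ediv_right _ _ two_ne_zero]

theorem one_sub_pow_succ_ne_zero {q : ℂ} (hq : ‖q‖ < 1) (n : ℕ) : 1 - q ^ (n + 1) ≠ 0 := by
  intro h
  have h1 : ‖q ^ (n + 1)‖ < 1 := by
    rw [norm_pow]; exact pow_lt_one₀ (norm_nonneg _) hq n.succ_ne_zero
  rw [← sub_eq_zero.mp h] at h1
  simp at h1

theorem thetaCoeff_zero (q : ℂ) : thetaCoeff q 0 = 1 := by simp [thetaCoeff]

theorem thetaCoeff_add_one {q : ℂ} (hq0 : q ≠ 0) (k : ℤ) :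
    thetaCoeff q (k + 1) = -thetaCoeff q k * q ^ k := by
  rw [thetaCoeff, thetaCoeff, Int.mul_sub_one_ediv_two_add_one, zpow_add₀ hq0,
    zpow_add_one₀ (by norm_num)]
  ring

theorem thetaCoeff_ne_zero {q : ℂ} (hq0 : q ≠ 0) (k : ℤ) : thetaCoeff q k ≠ 0 :=
  mul_ne_zero (zpow_ne_zero _ (by norm_num)) (zpow_ne_zero _ hq0)

theorem qPochRecip_sub_one {q : ℂ} (hq : ‖q‖ < 1) (m : ℤ) :
    qPochRecip q (m - 1) = (1 - q ^ m) * qPochRecip q m := by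
  rcases m with (_ | m) | m
  · rw [show Int.ofNat 0 - 1 = Int.negSucc 0 from rfl]
    simp [qPochRecip]
  · have h := one_sub_pow_succ_ne_zero hq m
    rw [show Int.ofNat (m + 1) - 1 = Int.ofNat m by simp]
    simp only [qPochRecip, Finset.prod_range_succ, mul_inv, Int.ofNat_eq_natCast, zpow_natCast]
    field_simp
  · simp [show Int.negSucc m - 1 = Int.negSucc (m + 1) by rfl, qPochRecip]

theorem HasSum.of_forall_eq {ι : Type*} {f g : ι → ℂ} {a b : ℂ} (h : HasSum f a)
    (hfg : ∀ k, g k = f k) (hab : b = a) : HasSum g b := by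
  rwa [hab, funext hfg]

/-- The finite form of the Jacobi triple product identity. -/
theorem hasSum_finite_triple_product {q z : ℂ} (hq0 : q ≠ 0) (hq : ‖q‖ < 1) (hz : z ≠ 0) (N : ℕ) :
    HasSum (fun k : ℤ ↦ (∏ i ∈ Finset.range (2 * N), (1 - q ^ (i + 1))) *
        qPochRecip q (N + k) * qPochRecip q (N - k) * (thetaCoeff q k * z ^ k))
      (∏ n ∈ Finset.range N, ((1 - z * q ^ n) * (1 - z⁻¹ * q ^ (n + 1)))) := by
  induction N with
  | zero =>
    have h0 : qPochRecip q 0 = 1 := by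
      rw [show (0 : ℤ) = Int.ofNat 0 from rfl]
      simp [qPochRecip]
    refine (hasSum_single (0 : ℤ) ?_).of_forall_eq (fun k ↦ rfl) ?_
    rotate_left
    · simp [h0, thetaCoeff_zero]
    · rintro ((_ | k) | k) hk
      · simp at hk
      · rw [show ((0 : ℕ) : ℤ) - Int.ofNat (k + 1) = Int.negSucc k by simp; omega]
        simp [qPochRecip]
      · rw [show ((0 : ℕ) : ℤ) + Int.negSucc k = Int.negSucc k by simp]
        simp [qPochRecip]
  | succ N ih =>
    have h1 := ih.mul_right (1 + q ^ (2 * N + 1))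
    have h2 := ((Equiv.addRight (-1 : ℤ)).hasSum_iff.mpr ih).mul_right (z * q ^ N)
    have h3 := ((Equiv.addRight (1 : ℤ)).hasSum_iff.mpr ih).mul_right (z⁻¹ * q ^ (N + 1))
    refine ((h1.sub h2).sub h3).of_forall_eq (fun k ↦ ?_) ?_
    · obtain ⟨l, rfl⟩ : ∃ l : ℤ, k = l + 1 := ⟨k - 1, (sub_add_cancel k 1).symm⟩
      have e1 := qPochRecip_sub_one hq (N + 1 + (l + 1))
      have e2 := qPochRecip_sub_one hq (N + 1 + (l + 1) - 1)
      have e3 := qPochRecip_sub_one hq (N + 1 - (l + 1))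
      have e4 := qPochRecip_sub_one hq (N + 1 - (l + 1) - 1)
      rw [show 2 * (N + 1) = 2 * N + 1 + 1 by ring, Finset.prod_range_succ, Finset.prod_range_succ]
      simp only [Function.comp, Equiv.coe_addRight]
      push_cast
      rw [show (N : ℤ) + (l + 1) = N + 1 + (l + 1) - 1 by ring,
        show (N : ℤ) - (l + 1) = N + 1 - (l + 1) - 1 by ring,
        show (N : ℤ) + (l + 1 + -1) = N + 1 + (l + 1) - 1 - 1 by ring,
        show (N : ℤ) - (l + 1 + -1) = N + 1 - (l + 1) by ring,
        show (N : ℤ) + (l + 1 + 1) = N + 1 + (l + 1) by ring,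
        show (N : ℤ) - (l + 1 + 1) = N + 1 - (l + 1) - 1 - 1 by ring,
        show l + 1 + -1 = l by ring, e2, e1, e4, e3, thetaCoeff_add_one hq0 (l + 1),
        thetaCoeff_add_one hq0 l]
      simp only [zpow_add₀ hq0, zpow_sub₀ hq0, zpow_add₀ hz, zpow_one, zpow_natCast]
      have hl := zpow_ne_zero l hq0
      clear e1 e2 e3 e4 h1 h2 h3 ih
      generalize ∏ i ∈ Finset.range (2 * N), (1 - q ^ (i + 1)) = P
      generalize q ^ l = y at *
      generalize thetaCoeff q l = b at *
      generalize z ^ l = w at *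
      field_simp
      ring
    · rw [Finset.prod_range_succ, ← mul_sub, ← mul_sub]
      congr 1
      field_simp
      ring

theorem multipliable_one_sub_mul_pow {q : ℂ} (hq : ‖q‖ < 1) (x : ℂ) :
    Multipliable fun n : ℕ ↦ 1 - x * q ^ n := by
  have h : Summable fun n : ℕ ↦ ‖-(x * q ^ n)‖ := by
    simpa using (summable_geometric_of_lt_one (norm_nonneg _) hq).mul_left ‖x‖
  simpa [sub_eq_add_neg] using multipliable_one_add_of_summable h

theorem tprod_one_sub_mul_pow_ne_zero {q : ℂ} (hq : ‖q‖ < 1) {x : ℂ}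
    (hx : ∀ n : ℕ, 1 - x * q ^ n ≠ 0) : ∏' n : ℕ, (1 - x * q ^ n) ≠ 0 := by
  have h : Summable fun n : ℕ ↦ ‖-(x * q ^ n)‖ := by
    simpa using (summable_geometric_of_lt_one (norm_nonneg _) hq).mul_left ‖x‖
  simpa [sub_eq_add_neg] using
    tprod_one_add_ne_zero_of_summable (by simpa [sub_eq_add_neg] using hx) h

theorem Eprod_eq_tprod (q : ℂ) : Eprod q = ∏' n : ℕ, (1 - q * q ^ n) := by
  simp only [Eprod, pow_succ']

theorem Eprod_ne_zero {q : ℂ} (hq : ‖q‖ < 1) : Eprod q ≠ 0 := by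
  rw [Eprod_eq_tprod]
  refine tprod_one_sub_mul_pow_ne_zero hq fun n ↦ ?_
  rw [← pow_succ']
  exact one_sub_pow_succ_ne_zero hq n

theorem tprod_theta {q : ℂ} (hq : ‖q‖ < 1) (z w : ℂ) :
    ∏' n : ℕ, ((1 - z * q ^ n) * (1 - w * q ^ (n + 1))) =
      (∏' n : ℕ, (1 - z * q ^ n)) * ∏' n : ℕ, (1 - w * q * q ^ n) := by
  rw [← (multipliable_one_sub_mul_pow hq z).tprod_mul (multipliable_one_sub_mul_pow hq (w * q))]
  simp only [pow_succ', mul_assoc]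

theorem multipliable_theta {q : ℂ} (hq : ‖q‖ < 1) (z w : ℂ) :
    Multipliable fun n : ℕ ↦ (1 - z * q ^ n) * (1 - w * q ^ (n + 1)) := by
  have h := (multipliable_one_sub_mul_pow hq z).mul (multipliable_one_sub_mul_pow hq (w * q))
  simpa only [pow_succ', mul_assoc] using h

theorem summable_norm_theta {q z : ℂ} (hq0 : q ≠ 0) (hq : ‖q‖ < 1) (hz : z ≠ 0) :
    Summable fun k : ℤ ↦ ‖thetaCoeff q k * z ^ k‖ := by
  have hne (k : ℤ) : thetaCoeff q k * z ^ k ≠ 0 :=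
    mul_ne_zero (thetaCoeff_ne_zero hq0 k) (zpow_ne_zero _ hz)
  have hlim (c : ℝ) : Tendsto (fun n : ℕ ↦ ‖q‖ ^ n * c) atTop (𝓝 0) := by
    simpa using (tendsto_pow_atTop_nhds_zero_of_lt_one (norm_nonneg q) hq).mul_const c
  refine Summable.of_nat_of_neg ?_ ?_
  · refine summable_of_ratio_test_tendsto_lt_one zero_lt_one
      (.of_forall fun n ↦ norm_ne_zero_iff.mpr (hne _)) ((hlim ‖z‖).congr fun n ↦ ?_)
    rw [norm_norm, norm_norm, eq_div_iff (norm_ne_zero_iff.mpr (hne _)), ← norm_pow, ← norm_mul,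
      ← norm_mul, Nat.cast_succ, thetaCoeff_add_one hq0, zpow_add_one₀ hz, ← norm_neg]
    congr 1
    simp only [zpow_natCast]
    ring
  · refine summable_of_ratio_test_tendsto_lt_one zero_lt_one
      (.of_forall fun n ↦ norm_ne_zero_iff.mpr (hne _)) ((hlim (‖q‖ * ‖z‖⁻¹)).congr fun n ↦ ?_)
    have h := thetaCoeff_add_one hq0 (-((n + 1 : ℕ) : ℤ))
    have h' := zpow_add_one₀ hz (-((n + 1 : ℕ) : ℤ))
    rw [show -((n + 1 : ℕ) : ℤ) + 1 = -(n : ℤ) by push_cast; ring] at h h'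
    rw [norm_norm, norm_norm, eq_div_iff (norm_ne_zero_iff.mpr (hne _)), h, h', ← norm_pow,
      ← norm_inv, ← norm_mul, ← norm_mul, ← norm_mul, ← norm_neg, zpow_neg, zpow_natCast]
    congr 1
    have : q ^ (n + 1) ≠ 0 := pow_ne_zero _ hq0
    field_simp
    ring

/-- **Jacobi triple product identity.** -/
theorem hasSum_triple_product {q z : ℂ} (hq0 : q ≠ 0) (hq : ‖q‖ < 1) (hz : z ≠ 0) :
    HasSum (fun k : ℤ ↦ thetaCoeff q k * z ^ k)
      (Eprod q * ∏' n : ℕ, ((1 - z * q ^ n) * (1 - z⁻¹ * q ^ (n + 1)))) := by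
  have hE := Eprod_ne_zero hq
  have hlim : Tendsto (fun n ↦ ∏ i ∈ Finset.range n, (1 - q ^ (i + 1))) atTop (𝓝 (Eprod q)) := by
    refine Multipliable.tendsto_prod_tprod_nat ?_
    simpa only [pow_succ'] using multipliable_one_sub_mul_pow hq q
  have hlim' : Tendsto (qPochRecip q) atTop (𝓝 (Eprod q)⁻¹) := by
    have h : Tendsto (fun m : ℤ ↦ (∏ i ∈ Finset.range m.toNat, (1 - q ^ (i + 1)))⁻¹) atTop
        (𝓝 (Eprod q)⁻¹) := (hlim.comp (f := Int.toNat)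
          (tendsto_atTop_atTop.mpr fun n ↦ ⟨n, fun m hm ↦ by lia⟩)).inv₀ hE
    refine h.congr' ((eventually_ge_atTop 0).mono fun m hm ↦ ?_)
    lift m to ℕ using hm
    rfl
  obtain ⟨C, hC⟩ := hlim.norm.bddAbove_range
  obtain ⟨D, hD⟩ := (hlim.inv₀ hE).norm.bddAbove_range
  have hD' (m : ℤ) : ‖qPochRecip q m‖ ≤ D := by
    rcases m with m | m
    · exact hD ⟨m, rfl⟩
    · simpa [qPochRecip] using (norm_nonneg _).trans (hD ⟨0, rfl⟩)
  have hD0 : 0 ≤ D := (norm_nonneg _).trans (hD' 0)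
  have hC0 : 0 ≤ C := (norm_nonneg _).trans (hC ⟨0, rfl⟩)
  have hS := summable_norm_theta hq0 hq hz
  have key := tendsto_tsum_of_dominated_convergence (𝓕 := atTop)
    (f := fun (N : ℕ) (k : ℤ) ↦ (∏ i ∈ Finset.range (2 * N), (1 - q ^ (i + 1))) *
        qPochRecip q (N + k) * qPochRecip q (N - k) * (thetaCoeff q k * z ^ k))
    (g := fun k ↦ Eprod q * (Eprod q)⁻¹ * (Eprod q)⁻¹ * (thetaCoeff q k * z ^ k))
    (hS.mul_left (C * D * D)) (fun k ↦ ?_) (.of_forall fun N k ↦ ?_)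
  · simp only [(hasSum_finite_triple_product hq0 hq hz _).tsum_eq] at key
    have := tendsto_nhds_unique key (multipliable_theta hq z z⁻¹).tendsto_prod_tprod_nat
    rw [tsum_mul_left, mul_inv_cancel₀ hE, one_mul] at this
    rw [← this, mul_inv_cancel_left₀ hE]
    exact hS.of_norm.hasSum
  · refine Tendsto.mul_const _ (Tendsto.mul (Tendsto.mul ?_ ?_) ?_)
    · exact hlim.comp (tendsto_atTop_atTop.mpr fun n ↦ ⟨n, by lia⟩)
    · exact hlim'.comp (tendsto_atTop_atTop.mpr fun n ↦ ⟨(n - k).toNat, by lia⟩)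
    · exact hlim'.comp (tendsto_atTop_atTop.mpr fun n ↦ ⟨(n + k).toNat, by lia⟩)
  · rw [norm_mul, norm_mul, norm_mul]
    gcongr
    · exact hC ⟨2 * N, rfl⟩
    · exact hD' _
    · exact hD' _

theorem Eprod_dissection {q : ℂ} (hq : ‖q‖ < 1) (n : ℕ) :
    Eprod q = ∏ i : Fin (n + 1), ∏' m : ℕ, (1 - q ^ (i.1 + 1) * (q ^ (n + 1)) ^ m) := by
  have hqn : ‖q ^ (n + 1)‖ < 1 := by
    rw [norm_pow]; exact pow_lt_one₀ (norm_nonneg _) hq n.succ_ne_zero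
  have hm : Multipliable fun k : ℕ ↦ 1 - q ^ (k + 1) := by
    simpa only [pow_succ'] using multipliable_one_sub_mul_pow hq q
  have hm' := (Nat.divModEquiv (n + 1)).symm.multipliable_iff.mpr hm
  rw [← Multipliable.tprod_finsetProd fun i _ ↦ multipliable_one_sub_mul_pow hqn _, Eprod,
    ← (Nat.divModEquiv (n + 1)).symm.tprod_eq]
  refine (hm'.tprod_prod' fun _ ↦ (hasProd_fintype _).multipliable).trans (tprod_congr fun m ↦ ?_)
  rw [tprod_fintype]
  refine Finset.prod_congr rfl fun i _ ↦ ?_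
  simp only [Function.comp, Nat.divModEquiv_symm_apply]
  ring

theorem prod_theta_pow {q : ℂ} (hq0 : q ≠ 0) (hq : ‖q‖ < 1) (n : ℕ) :
    (∏ i : Fin n, ∏' m : ℕ, ((1 - q ^ (i.1 + 1) * (q ^ (n + 1)) ^ m) *
      (1 - (q ^ (i.1 + 1))⁻¹ * (q ^ (n + 1)) ^ (m + 1)))) * Eprod (q ^ (n + 1)) ^ 2 =
      Eprod q ^ 2 := by
  have hqn : ‖q ^ (n + 1)‖ < 1 := by
    rw [norm_pow]; exact pow_lt_one₀ (norm_nonneg _) hq n.succ_ne_zero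
  have hE : Eprod q = (∏ i : Fin n, ∏' m : ℕ, (1 - q ^ (i.1 + 1) * (q ^ (n + 1)) ^ m)) *
      Eprod (q ^ (n + 1)) := by
    rw [Eprod_dissection hq n, Fin.prod_univ_castSucc, Eprod_eq_tprod]
    simp
  have hrev : ∏ i : Fin n, ∏' m : ℕ, (1 - (q ^ (i.1 + 1))⁻¹ * q ^ (n + 1) * (q ^ (n + 1)) ^ m) =
      ∏ i : Fin n, ∏' m : ℕ, (1 - q ^ (i.1 + 1) * (q ^ (n + 1)) ^ m) := by
    rw [← Equiv.prod_comp Fin.revPerm]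
    refine Finset.prod_congr rfl fun i _ ↦ ?_
    have h : (q ^ (i.rev.1 + 1))⁻¹ * q ^ (n + 1) = q ^ (i.1 + 1) := by
      rw [inv_mul_eq_iff_eq_mul₀ (pow_ne_zero _ hq0), ← pow_add, Fin.val_rev]
      congr 1
      lia
    simp only [Fin.revPerm_apply, h]
  simp only [tprod_theta hqn, Finset.prod_mul_distrib]
  rw [hrev, hE]
  ring

/-- A product of absolutely convergent series is the multiple series of the products. -/
theorem summable_norm_prod_and_tsum {n : ℕ} (f : Fin n → ℤ → ℂ) (hf : ∀ i, Summable (‖f i ·‖)) :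
    Summable (fun v : Fin n → ℤ ↦ ‖∏ i, f i (v i)‖) ∧
      ∑' v : Fin n → ℤ, ∏ i, f i (v i) = ∏ i, ∑' k, f i k := by
  induction n with
  | zero => exact ⟨(hasSum_fintype _).summable, by simp [tsum_fintype]⟩
  | succ n ih =>
    obtain ⟨h1, h2⟩ := ih (fun i ↦ f i.succ) fun i ↦ hf i.succ
    constructor
    · rw [← (Fin.consEquiv fun _ ↦ ℤ).summable_iff]
      refine (summable_mul_of_summable_norm (hf 0) h1).norm.congr fun p ↦ ?_
      simp [Fin.prod_univ_succ, Fin.consEquiv]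
    · rw [Fin.prod_univ_succ, ← h2, tsum_mul_tsum_of_summable_norm (hf 0) h1,
        ← (Fin.consEquiv fun _ ↦ ℤ).tsum_eq]
      simp [Fin.prod_univ_succ, Fin.consEquiv]

/-- The shift `a vⱼ + j ↦ a vⱼ + j + 1` of the positions encoded by a vector `v ∈ ℤᵃ`,
`a = n + 1`. -/
def positionShift (n : ℕ) : (Fin (n + 1) → ℤ) ≃ (Fin (n + 1) → ℤ) where
  toFun v := Fin.cons (v (Fin.last n) + 1) fun i ↦ v i.castSucc
  invFun w := Fin.snoc (fun i ↦ w i.succ) (w 0 - 1)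
  left_inv v := by
    ext i
    cases i using Fin.lastCases <;> simp
  right_inv w := by
    ext i
    cases i using Fin.cases <;> simp

theorem sum_positionShift {n : ℕ} (v : Fin (n + 1) → ℤ) :
    ∑ i, positionShift n v i = ∑ i, v i + 1 := by
  rw [Fin.sum_univ_succ, Fin.sum_univ_castSucc]
  simp only [positionShift, Equiv.coe_fn_mk, Fin.cons_zero, Fin.cons_succ]
  ring

/-- The exponent of `q` in the multiple theta series. -/
def coreExponent {a : ℕ} (v : Fin a → ℤ) : ℤ :=
  ∑ i, ((a : ℤ) * (v i * (v i - 1) / 2) + (i.1 : ℤ) * v i)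

theorem coreExponent_positionShift {n : ℕ} (v : Fin (n + 1) → ℤ) :
    coreExponent (positionShift n v) = coreExponent v + ∑ i, v i := by
  rw [coreExponent, coreExponent, Fin.sum_univ_succ, Fin.sum_univ_castSucc,
    Fin.sum_univ_castSucc v]
  simp only [positionShift, Equiv.coe_fn_mk, Fin.cons_zero, Fin.cons_succ, Fin.val_castSucc,
    Fin.val_succ, Fin.val_zero, Fin.val_last, Int.mul_sub_one_ediv_two_add_one]
  push_cast
  simp only [add_mul, Finset.sum_add_distrib, one_mul]
  ring

theorem coreExponent_of_sum_eq_zero {a : ℕ} {v : Fin a → ℤ} (hv : ∑ i, v i = 0) :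
    coreExponent v = (a : ℤ) * (∑ i, v i ^ 2) / 2 + ∑ i, (i.1 : ℤ) * v i := by
  have h (k : ℤ) : k ^ 2 = 2 * (k * (k - 1) / 2) + k := by
    rw [Int.mul_ediv_cancel' (Int.even_mul_pred_self k).two_dvd]
    ring
  have h2 : ∑ i, v i ^ 2 = 2 * ∑ i, v i * (v i - 1) / 2 := by
    rw [Finset.sum_congr rfl fun i _ ↦ h (v i), Finset.sum_add_distrib, hv, add_zero,
      Finset.mul_sum]
  rw [h2, mul_left_comm, Int.mul_ediv_cancel_left _ two_ne_zero, coreExponent,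
    Finset.sum_add_distrib, Finset.mul_sum]

theorem sum_zpow_positionShift {n : ℕ} {z : ℂ} (hz : z ≠ 0) (v : Fin (n + 1) → ℤ) :
    ∑ j : Fin (n + 1), z ^ (((n + 1 : ℕ) : ℤ) * positionShift n v j + (j.1 : ℤ)) =
      z * ∑ j : Fin (n + 1), z ^ (((n + 1 : ℕ) : ℤ) * v j + (j.1 : ℤ)) := by
  rw [Fin.sum_univ_succ, Fin.sum_univ_castSucc, mul_add, Finset.mul_sum, add_comm]
  simp only [← zpow_one_add₀ hz]
  simp only [positionShift, Equiv.coe_fn_mk, Fin.cons_zero, Fin.cons_succ, Fin.val_castSucc,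
    Fin.val_succ, Fin.val_zero, Fin.val_last]
  congr 1
  · refine Finset.sum_congr rfl fun i _ ↦ ?_
    congr 1
    push_cast
    ring
  · congr 1
    push_cast
    ring

theorem zpow_sum₀ {ι : Type*} {x : ℂ} (hx : x ≠ 0) (s : Finset ι) (f : ι → ℤ) :
    x ^ (∑ i ∈ s, f i) = ∏ i ∈ s, x ^ f i := by
  induction s using Finset.cons_induction with
  | empty => simp
  | cons i s hi ih => rw [Finset.sum_cons, Finset.prod_cons, zpow_add₀ hx, ih]

/-- The general term of the multiple theta series. -/
noncomputable def multiThetaTerm {a : ℕ} (q z : ℂ) (v : Fin a → ℤ) : ℂ :=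
  (-1) ^ (∑ i, v i) * q ^ coreExponent v * ∑ j : Fin a, z ^ ((a : ℤ) * v j + (j.1 : ℤ))

theorem multiThetaTerm_eq_sum {a : ℕ} {q z : ℂ} (hq0 : q ≠ 0) (hz : z ≠ 0) (v : Fin a → ℤ) :
    multiThetaTerm q z v = ∑ j : Fin a, z ^ j.1 * ∏ i : Fin a,
      thetaCoeff (q ^ a) (v i) * (q ^ i.1 * if i = j then z ^ a else 1) ^ v i := by
  rw [multiThetaTerm, Finset.mul_sum]
  refine Finset.sum_congr rfl fun j _ ↦ ?_
  simp only [thetaCoeff, mul_zpow, Finset.prod_mul_distrib]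
  have h : ∏ i, (if i = j then z ^ a else 1) ^ v i = z ^ ((a : ℤ) * v j) := by
    rw [Finset.prod_eq_single j (by simp +contextual) (by simp)]
    simp [zpow_mul]
  rw [h, zpow_add₀ hz, coreExponent, zpow_sum₀ (by norm_num), zpow_sum₀ hq0]
  simp only [zpow_add₀ hq0, zpow_mul, zpow_natCast, Finset.prod_mul_distrib]
  ring

theorem hasSum_multiThetaTerm {n : ℕ} {q z : ℂ} (hq0 : q ≠ 0) (hq : ‖q‖ < 1) (hz : z ≠ 0) :
    HasSum (multiThetaTerm (a := n + 1) q z)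
      (Eprod (q ^ (n + 1)) ^ (n + 1) *
        (∏' m : ℕ, ((1 - z ^ (n + 1) * (q ^ (n + 1)) ^ m) *
          (1 - z⁻¹ ^ (n + 1) * (q ^ (n + 1)) ^ (m + 1)))) *
        ∏ i : Fin n, ∏' m : ℕ, ((1 - q ^ (i.1 + 1) * (q ^ (n + 1)) ^ m) *
          (1 - (q ^ (i.1 + 1))⁻¹ * (q ^ (n + 1)) ^ (m + 1)))) := by
  have hqn : ‖q ^ (n + 1)‖ < 1 := by
    rw [norm_pow]; exact pow_lt_one₀ (norm_nonneg _) hq n.succ_ne_zero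
  have hqn0 : q ^ (n + 1) ≠ 0 := pow_ne_zero _ hq0
  set x : Fin (n + 1) → Fin (n + 1) → ℂ :=
    fun j i ↦ q ^ i.1 * if i = j then z ^ (n + 1) else 1 with hx
  have hx0 (j i) : x j i ≠ 0 := by
    simp only [hx]
    split_ifs <;> simp [hq0, hz]
  have hsum (j : Fin (n + 1)) : HasSum (fun v : Fin (n + 1) → ℤ ↦
      z ^ j.1 * ∏ i, thetaCoeff (q ^ (n + 1)) (v i) * x j i ^ v i)
      (z ^ j.1 * ∏ i, (Eprod (q ^ (n + 1)) * ∏' m : ℕ, ((1 - x j i * (q ^ (n + 1)) ^ m) *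
        (1 - (x j i)⁻¹ * (q ^ (n + 1)) ^ (m + 1))))) := by
    obtain ⟨h1, h2⟩ := summable_norm_prod_and_tsum
      (fun i k ↦ thetaCoeff (q ^ (n + 1)) k * x j i ^ k)
      fun i ↦ summable_norm_theta hqn0 hqn (hx0 j i)
    simp only [(hasSum_triple_product hqn0 hqn (hx0 j _)).tsum_eq] at h2
    rw [← h2]
    exact h1.of_norm.hasSum.mul_left _
  refine (hasSum_sum fun j _ ↦ hsum j).of_forall_eq (multiThetaTerm_eq_sum hq0 hz) ?_
  rw [Fin.sum_univ_succ, Finset.sum_eq_zero (s := Finset.univ (α := Fin n)), add_zero,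
    Fin.prod_univ_succ, Finset.prod_mul_distrib]
  · simp [hx, Fin.succ_ne_zero]
    ring
  · intro j _
    rw [Fin.prod_univ_succ, tprod_of_exists_eq_zero ⟨0, by simp [hx, (Fin.succ_ne_zero j).symm]⟩]
    simp

theorem multiThetaTerm_positionShift {n : ℕ} {q z : ℂ} (hq0 : q ≠ 0) (hz : z ≠ 0)
    (v : Fin (n + 1) → ℤ) :
    multiThetaTerm q z (positionShift n v) = -z * q ^ (∑ i, v i) * multiThetaTerm q z v := by
  rw [multiThetaTerm, multiThetaTerm, sum_positionShift, coreExponent_positionShift,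
    sum_zpow_positionShift hz, zpow_add_one₀ (by norm_num), zpow_add₀ hq0]
  ring

theorem tsum_multiThetaTerm_fiber {n : ℕ} {q z : ℂ} (hq0 : q ≠ 0) (hz : z ≠ 0) (s : ℤ) :
    ∑' v : {v : Fin (n + 1) → ℤ // ∑ i, v i = s}, multiThetaTerm q z v.1 =
      thetaCoeff q s * z ^ s *
        ∑' v : {v : Fin (n + 1) → ℤ // ∑ i, v i = 0}, multiThetaTerm q z v.1 := by
  have hstep (s : ℤ) :
      ∑' v : {v : Fin (n + 1) → ℤ // ∑ i, v i = s + 1}, multiThetaTerm q z v.1 =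
        -z * q ^ s * ∑' v : {v : Fin (n + 1) → ℤ // ∑ i, v i = s}, multiThetaTerm q z v.1 := by
    rw [← tsum_mul_left, ← ((positionShift n).subtypeEquiv
      (p := fun v ↦ ∑ i, v i = s) (q := fun v ↦ ∑ i, v i = s + 1)
      fun v ↦ by rw [sum_positionShift, add_left_inj]).tsum_eq]
    refine tsum_congr fun v ↦ ?_
    rw [Equiv.subtypeEquiv_apply, multiThetaTerm_positionShift hq0 hz, v.2]
  have hcoeff (s : ℤ) :
      thetaCoeff q (s + 1) * z ^ (s + 1) = -z * q ^ s * (thetaCoeff q s * z ^ s) := by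
    rw [thetaCoeff_add_one hq0, zpow_add_one₀ hz]
    ring
  have hne (s : ℤ) : -z * q ^ s ≠ 0 := mul_ne_zero (neg_ne_zero.mpr hz) (zpow_ne_zero _ hq0)
  induction s using Int.induction_on with
  | zero => simp [thetaCoeff_zero]
  | succ s ih => rw [hstep, ih, hcoeff, ← mul_assoc]
  | pred s ih =>
    have h1 := hstep (-s - 1)
    have h2 := hcoeff (-s - 1)
    rw [sub_add_cancel] at h1 h2
    rw [h1, h2, mul_assoc (-z * _)] at ih
    exact mul_left_cancel₀ (hne _) ih

theorem tsum_multiThetaTerm_zero_mul {n : ℕ} {q z : ℂ} (hq0 : q ≠ 0) (hq : ‖q‖ < 1) (hz : z ≠ 0) :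
    (∑' v : {v : Fin (n + 1) → ℤ // ∑ i, v i = 0}, multiThetaTerm q z v.1) *
        (Eprod q * ∏' m : ℕ, ((1 - z * q ^ m) * (1 - z⁻¹ * q ^ (m + 1)))) =
      Eprod (q ^ (n + 1)) ^ (n + 1) *
        (∏' m : ℕ, ((1 - z ^ (n + 1) * (q ^ (n + 1)) ^ m) *
          (1 - z⁻¹ ^ (n + 1) * (q ^ (n + 1)) ^ (m + 1)))) *
        ∏ i : Fin n, ∏' m : ℕ, ((1 - q ^ (i.1 + 1) * (q ^ (n + 1)) ^ m) *
          (1 - (q ^ (i.1 + 1))⁻¹ * (q ^ (n + 1)) ^ (m + 1))) := by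
  have h := (hasSum_multiThetaTerm (n := n) hq0 hq hz).tsum_fiberwise fun v ↦ ∑ i, v i
  refine (((hasSum_triple_product hq0 hq hz).mul_left _).of_forall_eq (fun s ↦ ?_) rfl).unique h
  rw [mul_comm, ← tsum_multiThetaTerm_fiber hq0 hz s]
  exact (Equiv.subtypeEquivRight fun v ↦ by simp).tsum_eq fun v :
    {v : Fin (n + 1) → ℤ // ∑ i, v i = s} ↦ multiThetaTerm q z v.1

theorem two_mul_coreExponent_summand (a i v : ℤ) :
    2 * (a * (v * (v - 1) / 2) + i * v) = v * (a * (v - 1) + 2 * i) := by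
  have h := Int.mul_ediv_cancel' (Int.even_mul_pred_self v).two_dvd
  linear_combination a * h

theorem coreExponent_summand_nonneg {a i : ℤ} (hi : 0 ≤ i) (hia : i < a) (v : ℤ) :
    0 ≤ a * (v * (v - 1) / 2) + i * v := by
  have h := two_mul_coreExponent_summand a i v
  rcases lt_trichotomy v 0 with hv | rfl | hv
  · have : a * (v - 1) + 2 * i ≤ 0 := by nlinarith
    nlinarith
  · simp
  · have : 0 ≤ a * (v - 1) + 2 * i := by nlinarith
    nlinarith

theorem eq_zero_of_coreExponent_summand_eq_zero {a i v : ℤ} (hi : 0 < i) (hia : i < a)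
    (h0 : a * (v * (v - 1) / 2) + i * v = 0) : v = 0 := by
  have h := two_mul_coreExponent_summand a i v
  rw [h0, mul_zero, eq_comm, mul_eq_zero] at h
  rcases h with h | h
  · exact h
  · rcases le_or_gt v 0 with hv | hv
    · rcases hv.eq_or_lt with hv | hv
      · exact hv
      · nlinarith
    · nlinarith

theorem eq_zero_of_coreExponent_eq_zero {a : ℕ} {v : Fin a → ℤ} (hv : ∑ i, v i = 0)
    (h : coreExponent v = 0) : v = 0 := by
  have hnn (i : Fin a) : 0 ≤ (a : ℤ) * (v i * (v i - 1) / 2) + (i.1 : ℤ) * v i :=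
    coreExponent_summand_nonneg (by positivity) (by exact_mod_cast i.2) _
  have hz := (Finset.sum_eq_zero_iff_of_nonneg fun i _ ↦ hnn i).mp h
  have hpos (i : Fin a) (hi : 0 < i.1) : v i = 0 :=
    eq_zero_of_coreExponent_summand_eq_zero (by exact_mod_cast hi) (by exact_mod_cast i.2)
      (hz i (Finset.mem_univ i))
  ext i
  rcases Nat.eq_zero_or_pos i.1 with hi | hi
  · rw [Pi.zero_apply, ← hv, Finset.sum_eq_single i (fun j _ hj ↦ hpos j ?_) (by simp)]
    exact Nat.pos_of_ne_zero fun hj0 ↦ hj (Fin.ext (hj0.trans hi.symm))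
  · exact hpos i hi

theorem tsum_eq_tsum_multiThetaTerm (a : ℕ) (q z : ℂ) :
    ∑' v : {v : Fin a → ℤ // ∑ i, v i = 0},
        q ^ (((a : ℤ) * ∑ i, (v.1 i) ^ 2) / 2 + ∑ i, (i.1 : ℤ) * v.1 i) *
          ∑ j : Fin a, z ^ ((a : ℤ) * v.1 j + (j.1 : ℤ)) =
      ∑' v : {v : Fin a → ℤ // ∑ i, v i = 0}, multiThetaTerm q z v.1 :=
  tsum_congr fun v ↦ by
    rw [multiThetaTerm, coreExponent_of_sum_eq_zero v.2, v.2, zpow_zero, one_mul]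

/-- Theorem 1 (Berkovich–Garvan), a `z`-analogue of Klyachko's identity:
for an integer `a ≥ 2`, `z ≠ 0` and `|q| < 1` (with `z` avoiding the zeros
`q^k`, `k ∈ ℤ`, of the denominator),
`∑_{n ∈ ℤᵃ, n·1=0} q^{(a/2) n·n + b_a·n} ∑_{j=0}^{a-1} z^{a nⱼ + j}
 = E(q) E(q^a)^{a-2} ∏_{n ≥ 1} (1-zᵃq^{a(n-1)})(1-z⁻ᵃq^{an}) /
   ((1-zq^{n-1})(1-z⁻¹qⁿ))`. -/
theorem z_analogue_klyachko (a : ℕ) (ha : 2 ≤ a) (z q : ℂ) (hz : z ≠ 0)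
    (hq : ‖q‖ < 1) (hzq : ∀ k : ℤ, z ≠ q ^ k) :
    ∑' v : {v : Fin a → ℤ // ∑ i, v i = 0},
        q ^ (((a : ℤ) * ∑ i, (v.1 i) ^ 2) / 2 + ∑ i, (i.1 : ℤ) * v.1 i) *
          ∑ j : Fin a, z ^ ((a : ℤ) * v.1 j + (j.1 : ℤ)) =
      Eprod q * Eprod (q ^ a) ^ (a - 2) *
        ∏' n : ℕ, ((1 - z ^ a * (q ^ a) ^ n) * (1 - (z⁻¹) ^ a * (q ^ a) ^ (n + 1))) /
          ((1 - z * q ^ n) * (1 - z⁻¹ * q ^ (n + 1))) := by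
  rw [tsum_eq_tsum_multiThetaTerm]
  rcases eq_or_ne q 0 with rfl | hq0
  · have ha0 : a ≠ 0 := by lia
    have hz1 : z ≠ 1 := by simpa using hzq 0
    rw [tsum_eq_single ⟨0, by simp⟩ fun v hv ↦ ?_, tprod_eq_mulSingle 0 fun n hn ↦ ?_]
    · have hz1' : 1 - z ≠ 0 := sub_ne_zero.mpr hz1.symm
      simp [multiThetaTerm, coreExponent, Eprod, ha0, Fin.sum_univ_eq_sum_range (fun j ↦ z ^ j),
        eq_div_iff hz1', geom_sum_mul_neg]
    · simp [hn, ha0]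
    · have : coreExponent v.1 ≠ 0 := fun h ↦
        hv (Subtype.ext (eq_zero_of_coreExponent_eq_zero v.2 h))
      simp [multiThetaTerm, zero_zpow _ this]
  obtain ⟨m, rfl⟩ := Nat.exists_eq_add_of_le' ha
  have hqa : ‖q ^ (m + 1 + 1)‖ < 1 := by
    rw [norm_pow]; exact pow_lt_one₀ (norm_nonneg _) hq (m + 1).succ_ne_zero
  have hden : ∏' n : ℕ, ((1 - z * q ^ n) * (1 - z⁻¹ * q ^ (n + 1))) ≠ 0 := by
    rw [tprod_theta hq]
    refine mul_ne_zero (tprod_one_sub_mul_pow_ne_zero hq fun n h ↦ hzq (-n) ?_)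
      (tprod_one_sub_mul_pow_ne_zero hq fun n h ↦ hzq (n + 1 : ℕ) ?_)
    · rw [zpow_neg, zpow_natCast]
      exact eq_inv_of_mul_eq_one_left (sub_eq_zero.mp h).symm
    · rw [zpow_natCast, pow_succ']
      rw [mul_assoc, sub_eq_zero, eq_comm, inv_mul_eq_one₀ hz] at h
      exact h
  have hdiv := (multipliable_theta hqa (z ^ (m + 1 + 1)) (z⁻¹ ^ (m + 1 + 1))).tprod_div₀
    (multipliable_theta hq z z⁻¹) hden
  have key := tsum_multiThetaTerm_zero_mul (n := m + 1) hq0 hq hz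
  have hprod := prod_theta_pow hq0 hq (m + 1)
  rw [show m + 2 = m + 1 + 1 from rfl, hdiv, Nat.add_sub_cancel (m := 2) (n := m), ← mul_div_assoc,
    eq_div_iff hden]
  refine mul_left_cancel₀ (Eprod_ne_zero hq) ?_
  linear_combination key + Eprod (q ^ (m + 1 + 1)) ^ m *
    (∏' n : ℕ, ((1 - z ^ (m + 1 + 1) * (q ^ (m + 1 + 1)) ^ n) *
      (1 - z⁻¹ ^ (m + 1 + 1) * (q ^ (m + 1 + 1)) ^ (n + 1)))) * hprod
end
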